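/- Let A be a skew left brace, and define Γ̄₁(A) := A and Γ̄_n(A) := the subgroup of (A,·) generated by A*Γ̄_{n-1}(A) and [A,Γ̄_{n-1}(A)]·. Then for all integers s ≥ r ≥ 1, all u ∈ Ann_s(A) and all v ∈ Γ̄_r(A), both [u,v]· ∈ Ann_{s-r}(A) and u*v ∈ Ann_{s-r}(A). -/

import Mathlib

set_option linter.unusedVariables false

universe u v

/-- A skew left brace: a carrier with two group structures `(A,·)` (written `dmul`) and
`(A,∘)` (written `cmul`) sharing the same identity `ident`, satisfying
`a ∘ (b · c) = (a ∘ b) · a⁻¹ · (a ∘ c)`. -/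
class SkewBrace (A : Type u) where
  dmul : A → A → A
  ident : A
  dinv : A → A
  cmul : A → A → A
  cinv : A → A
  dmul_assoc : ∀ a b c : A, dmul (dmul a b) c = dmul a (dmul b c)
  ident_dmul : ∀ a : A, dmul ident a = a
  dmul_ident : ∀ a : A, dmul a ident = a
  dinv_dmul : ∀ a : A, dmul (dinv a) a = ident
  dmul_dinv : ∀ a : A, dmul a (dinv a) = ident
  cmul_assoc : ∀ a b c : A, cmul (cmul a b) c = cmul a (cmul b c)
  ident_cmul : ∀ a : A, cmul ident a = a
  cmul_ident : ∀ a : A, cmul a ident = a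
  cinv_cmul : ∀ a : A, cmul (cinv a) a = ident
  cmul_cinv : ∀ a : A, cmul a (cinv a) = ident
  compat : ∀ a b c : A, cmul a (dmul b c) = dmul (dmul (cmul a b) (dinv a)) (cmul a c)

namespace SkewBrace

variable {A : Type u} [SkewBrace A]

/-- The lambda map `λ_a(b) = a⁻¹ · (a ∘ b)`. -/
def lam (a b : A) : A := dmul (dinv a) (cmul a b)

/-- The star operation `a * b = λ_a(b) · b⁻¹`. -/
def bstar (a b : A) : A := dmul (lam a b) (dinv b)

/-- The dot commutator `[a,b]· = a · b · a⁻¹ · b⁻¹`. -/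
def dcomm (a b : A) : A := dmul (dmul (dmul a b) (dinv a)) (dinv b)

/-- The circle commutator `[a,b]∘ = a ∘ b ∘ ā ∘ b̄`. -/
def ccomm (a b : A) : A := cmul (cmul (cmul a b) (cinv a)) (cinv b)

/-- Membership in the subgroup of `(A,·)` generated by a subset. -/
inductive dclosure (S : Set A) : A → Prop
  | mem {x : A} : x ∈ S → dclosure S x
  | one : dclosure S ident
  | mul {x y : A} : dclosure S x → dclosure S y → dclosure S (dmul x y)
  | inv {x : A} : dclosure S x → dclosure S (dinv x)

/-- The subgroup of `(A,·)` generated by a subset, as a set. -/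
def dcl (S : Set A) : Set A := {x | dclosure S x}

/-- Membership in the subgroup of `(A,∘)` generated by a subset. -/
inductive cclosure (S : Set A) : A → Prop
  | mem {x : A} : x ∈ S → cclosure S x
  | one : cclosure S ident
  | mul {x y : A} : cclosure S x → cclosure S y → cclosure S (cmul x y)
  | inv {x : A} : cclosure S x → cclosure S (cinv x)

/-- The subgroup of `(A,∘)` generated by a subset, as a set. -/
def ccl (S : Set A) : Set A := {x | cclosure S x}

/-- The set `{x * y : x ∈ I, y ∈ J}` (star values). -/
def starSet (I J : Set A) : Set A := {x | ∃ a ∈ I, ∃ b ∈ J, x = bstar a b}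

/-- The set of dot commutators `[a,b]·` with `a ∈ I`, `b ∈ J`. -/
def dcommSet (I J : Set A) : Set A := {x | ∃ a ∈ I, ∃ b ∈ J, x = dcomm a b}

/-- The set of circle commutators `[a,b]∘` with `a ∈ I`, `b ∈ J`. -/
def ccommSet (I J : Set A) : Set A := {x | ∃ a ∈ I, ∃ b ∈ J, x = ccomm a b}

/-- The lower central series `Γ_n(A)` of the skew brace `A` (`Gamma A n = Γ_n(A)` for `n ≥ 1`):
`Γ₁(A) = A` and `Γ_n(A) = ⟨A * Γ_{n-1}(A), Γ_{n-1}(A) * A, [A,Γ_{n-1}(A)]·⟩·`. -/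
def Gamma (A : Type u) [SkewBrace A] : ℕ → Set A
  | 0 => Set.univ
  | 1 => Set.univ
  | (n+2) =>
      dcl (starSet Set.univ (Gamma A (n+1)) ∪ starSet (Gamma A (n+1)) Set.univ ∪
        dcommSet Set.univ (Gamma A (n+1)))

/-- The lower central series `γ_n(A,∘)` of the group `(A,∘)`
(`gammaCirc A n = γ_n(A,∘)` for `n ≥ 1`). -/
def gammaCirc (A : Type u) [SkewBrace A] : ℕ → Set A
  | 0 => Set.univ
  | 1 => Set.univ
  | (n+2) => ccl (ccommSet (gammaCirc A (n+1)) Set.univ)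

/-- The series `Γ̄_n(A)`: `Γ̄₁(A) = A`, `Γ̄_n(A) = ⟨A * Γ̄_{n-1}(A), [A, Γ̄_{n-1}(A)]·⟩·`. -/
def GammaBar (A : Type u) [SkewBrace A] : ℕ → Set A
  | 0 => Set.univ
  | 1 => Set.univ
  | (n+2) =>
      dcl (starSet Set.univ (GammaBar A (n+1)) ∪ dcommSet Set.univ (GammaBar A (n+1)))

/-- The annihilator series: `AnnS A n = Ann_n(A)`, with `Ann_0(A) = 1` and
`Ann_n(A) = {a | a*b, b*a, [a,b]· ∈ Ann_{n-1}(A) for all b}`. -/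
def AnnS (A : Type u) [SkewBrace A] : ℕ → Set A
  | 0 => {ident}
  | (n+1) => {a | ∀ b : A, bstar a b ∈ AnnS A n ∧ bstar b a ∈ AnnS A n ∧ dcomm a b ∈ AnnS A n}

/-- The alphabet `X = {γ·, γ̄·, *, *̄}` of brace commutator symbols. -/
inductive BWord : Type
  | g | gbar | s | sbar

/-- Evaluation of a single symbol of `X`. -/
def evalX : BWord → A → A → A
  | BWord.g => dcomm
  | BWord.gbar => fun a b => dcomm b a
  | BWord.s => bstar
  | BWord.sbar => fun a b => bstar b a

/-- `evalW e a n` is the value `m(a₀ a₁ ⋯ a_n)` of the degree-`n` brace commutator word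
`m = (e 0)(e 1)⋯(e (n-1))` on the arguments `a 0, …, a n`:
`m(a₀ ⋯ a_n) = (e 0)(a₀, (e 1)(a₁, …, (e (n-1))(a_{n-1}, a_n)⋯))`. -/
def evalW : (ℕ → BWord) → (ℕ → A) → ℕ → A
  | _, a, 0 => a 0
  | e, a, (n+1) => evalX (e 0) (a 0) (evalW (fun i => e (i+1)) (fun i => a (i+1)) n)

/-- `Asub A t = A_{(t)}`, the subgroup of `(A,·)` generated by all values of brace commutator
words of degree `≥ t`. -/
def Asub (A : Type u) [SkewBrace A] (t : ℕ) : Set A :=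
  dcl {x | ∃ s : ℕ, t ≤ s ∧ ∃ (e : ℕ → BWord) (a : ℕ → A), x = evalW e a s}

/-- `Sset A r = S_r(A)`, the set of all values of brace commutator words of degree exactly `r`
(`S_0(A) = A`). -/
def Sset (A : Type u) [SkewBrace A] (r : ℕ) : Set A :=
  {x | ∃ (e : ℕ → BWord) (a : ℕ → A), x = evalW e a r}

/-- `cosetRel I a b` says that `b` lies in the coset `I · a`. -/
def cosetRel (I : Set A) (a b : A) : Prop := ∃ c ∈ I, b = dmul c a

/-- The class `I_n`: the maps `φ_m : (A/Ann_n(A))^{n+1} → A_{(n)}`,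
`(Ann_n(A)a₁, …, Ann_n(A)a_{n+1}) ↦ m(a₁⋯a_{n+1})`, are well defined for every word `m` of
degree `n`. -/
def InClass (A : Type u) [SkewBrace A] (n : ℕ) : Prop :=
  ∀ (e : ℕ → BWord) (a b : ℕ → A),
    (∀ i : ℕ, i ≤ n → cosetRel (AnnS A n) (a i) (b i)) →
    evalW e b n = evalW e a n

/-- A skew left brace `(A,·,∘)` is symmetric if `(A,∘,·)` is also a skew left brace, i.e.
`a · (b ∘ c) = (a · b) ∘ ā ∘ (a · c)`. -/
def IsSymmetric (A : Type u) [SkewBrace A] : Prop :=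
  ∀ a b c : A, dmul a (cmul b c) = cmul (cmul (dmul a b) (cinv a)) (dmul a c)

/-- A sub-skew brace: a subset which is a subgroup of both `(A,·)` and `(A,∘)`. -/
structure IsSubBrace (A : Type u) [SkewBrace A] (S : Set A) : Prop where
  ident_mem : ident ∈ S
  dmul_mem : ∀ {x y : A}, x ∈ S → y ∈ S → dmul x y ∈ S
  dinv_mem : ∀ {x : A}, x ∈ S → dinv x ∈ S
  cmul_mem : ∀ {x y : A}, x ∈ S → y ∈ S → cmul x y ∈ S
  cinv_mem : ∀ {x : A}, x ∈ S → cinv x ∈ S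

/-- An ideal of a skew brace: a subgroup of `(A,·)`, normal in `(A,·)` and `(A,∘)`,
and invariant under all `λ_a`. -/
structure IsIdeal (A : Type u) [SkewBrace A] (I : Set A) : Prop where
  ident_mem : ident ∈ I
  dmul_mem : ∀ {x y : A}, x ∈ I → y ∈ I → dmul x y ∈ I
  dinv_mem : ∀ {x : A}, x ∈ I → dinv x ∈ I
  dconj_mem : ∀ (a : A) {x : A}, x ∈ I → dmul (dmul a x) (dinv a) ∈ I
  cconj_mem : ∀ (a : A) {x : A}, x ∈ I → cmul (cmul a x) (cinv a) ∈ I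
  lam_mem : ∀ (a : A) {x : A}, x ∈ I → lam a x ∈ I

/-- A homomorphism of skew braces. -/
structure IsBraceHom {A : Type u} {B : Type v} [SkewBrace A] [SkewBrace B] (f : A → B) : Prop where
  map_dmul : ∀ x y : A, f (dmul x y) = dmul (f x) (f y)
  map_cmul : ∀ x y : A, f (cmul x y) = cmul (f x) (f y)

/-- The data of an isoclinism of skew braces along ideals `I` of `A` and `J` of `B`:
`ξ` induces a brace isomorphism `A/I → B/J` and `θ` restricts to a brace isomorphism
`Γ₂(A) → Γ₂(B)` compatible with the commutator and star maps. -/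
structure IsoclinismData (A : Type u) (B : Type v) [SkewBrace A] [SkewBrace B]
    (I : Set A) (J : Set B) (ξ θ : A → B) : Prop where
  xi_resp : ∀ a a' : A, cosetRel I a a' ↔ cosetRel J (ξ a) (ξ a')
  xi_surj : ∀ b : B, ∃ a : A, cosetRel J b (ξ a)
  xi_dmul : ∀ a a' : A, cosetRel J (dmul (ξ a) (ξ a')) (ξ (dmul a a'))
  xi_cmul : ∀ a a' : A, cosetRel J (cmul (ξ a) (ξ a')) (ξ (cmul a a'))
  theta_maps : ∀ x ∈ Gamma A 2, θ x ∈ Gamma B 2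
  theta_inj : ∀ x ∈ Gamma A 2, ∀ y ∈ Gamma A 2, θ x = θ y → x = y
  theta_surj : ∀ y ∈ Gamma B 2, ∃ x ∈ Gamma A 2, θ x = y
  theta_dmul : ∀ x ∈ Gamma A 2, ∀ y ∈ Gamma A 2, θ (dmul x y) = dmul (θ x) (θ y)
  theta_cmul : ∀ x ∈ Gamma A 2, ∀ y ∈ Gamma A 2, θ (cmul x y) = cmul (θ x) (θ y)
  compat_dcomm : ∀ a₁ a₂ : A, ∀ b₁ b₂ : B, cosetRel J b₁ (ξ a₁) → cosetRel J b₂ (ξ a₂) →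
    θ (dcomm a₁ a₂) = dcomm b₁ b₂
  compat_star : ∀ a₁ a₂ : A, ∀ b₁ b₂ : B, cosetRel J b₁ (ξ a₁) → cosetRel J b₂ (ξ a₂) →
    θ (bstar a₁ a₂) = bstar b₁ b₂

/-- Isoclinism (1-isoclinism) of skew left braces. -/
def Isoclinic (A : Type u) (B : Type v) [SkewBrace A] [SkewBrace B] : Prop :=
  ∃ ξ θ : A → B, IsoclinismData A B (AnnS A 1) (AnnS B 1) ξ θ

/-- The data of an `n`-isoclinism of skew braces: `ξ` induces a brace isomorphism
`A/Ann_n(A) → B/Ann_n(B)` and `θ` restricts to a brace isomorphism `A_{(n)} → B_{(n)}`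
commuting with all brace commutator word maps of degree `n`. -/
structure IsoclinismDataN (A : Type u) (B : Type v) [SkewBrace A] [SkewBrace B]
    (n : ℕ) (ξ θ : A → B) : Prop where
  xi_resp : ∀ a a' : A, cosetRel (AnnS A n) a a' ↔ cosetRel (AnnS B n) (ξ a) (ξ a')
  xi_surj : ∀ b : B, ∃ a : A, cosetRel (AnnS B n) b (ξ a)
  xi_dmul : ∀ a a' : A, cosetRel (AnnS B n) (dmul (ξ a) (ξ a')) (ξ (dmul a a'))
  xi_cmul : ∀ a a' : A, cosetRel (AnnS B n) (cmul (ξ a) (ξ a')) (ξ (cmul a a'))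
  theta_maps : ∀ x ∈ Asub A n, θ x ∈ Asub B n
  theta_inj : ∀ x ∈ Asub A n, ∀ y ∈ Asub A n, θ x = θ y → x = y
  theta_surj : ∀ y ∈ Asub B n, ∃ x ∈ Asub A n, θ x = y
  theta_dmul : ∀ x ∈ Asub A n, ∀ y ∈ Asub A n, θ (dmul x y) = dmul (θ x) (θ y)
  theta_cmul : ∀ x ∈ Asub A n, ∀ y ∈ Asub A n, θ (cmul x y) = cmul (θ x) (θ y)
  compat : ∀ (e : ℕ → BWord) (a : ℕ → A) (b : ℕ → B),
    (∀ i : ℕ, i ≤ n → cosetRel (AnnS B n) (b i) (ξ (a i))) →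
    θ (evalW e a n) = evalW e b n

/-- `n`-isoclinism of skew left braces. -/
def IsoclinicN (A : Type u) (B : Type v) [SkewBrace A] [SkewBrace B] (n : ℕ) : Prop :=
  ∃ ξ θ : A → B, IsoclinismDataN A B n ξ θ

/-- The product set `S · T = {s · t : s ∈ S, t ∈ T}` in `(A,·)`. -/
def setDProd (S T : Set A) : Set A := {x | ∃ s ∈ S, ∃ t ∈ T, x = dmul s t}

/-- The product set `S ∘ T = {s ∘ t : s ∈ S, t ∈ T}` in `(A,∘)`. -/
def setCProd (S T : Set A) : Set A := {x | ∃ s ∈ S, ∃ t ∈ T, x = cmul s t}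

/-- The skew brace structure on a sub-skew brace. -/
def subBrace (S : Set A) (h : IsSubBrace A S) : SkewBrace S where
  dmul x y := ⟨dmul x.1 y.1, h.dmul_mem x.2 y.2⟩
  ident := ⟨ident, h.ident_mem⟩
  dinv x := ⟨dinv x.1, h.dinv_mem x.2⟩
  cmul x y := ⟨cmul x.1 y.1, h.cmul_mem x.2 y.2⟩
  cinv x := ⟨cinv x.1, h.cinv_mem x.2⟩
  dmul_assoc a b c := Subtype.ext (dmul_assoc a.1 b.1 c.1)
  ident_dmul a := Subtype.ext (ident_dmul a.1)
  dmul_ident a := Subtype.ext (dmul_ident a.1)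
  dinv_dmul a := Subtype.ext (dinv_dmul a.1)
  dmul_dinv a := Subtype.ext (dmul_dinv a.1)
  cmul_assoc a b c := Subtype.ext (cmul_assoc a.1 b.1 c.1)
  ident_cmul a := Subtype.ext (ident_cmul a.1)
  cmul_ident a := Subtype.ext (cmul_ident a.1)
  cinv_cmul a := Subtype.ext (cinv_cmul a.1)
  cmul_cinv a := Subtype.ext (cmul_cinv a.1)
  compat a b c := Subtype.ext (compat a.1 b.1 c.1)

/-- The direct product of two skew braces, with componentwise operations. -/
instance prodBrace (A : Type u) (B : Type v) [SkewBrace A] [SkewBrace B] :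
    SkewBrace (A × B) where
  dmul p q := (dmul p.1 q.1, dmul p.2 q.2)
  ident := (ident, ident)
  dinv p := (dinv p.1, dinv p.2)
  cmul p q := (cmul p.1 q.1, cmul p.2 q.2)
  cinv p := (cinv p.1, cinv p.2)
  dmul_assoc a b c := Prod.ext_iff.mpr ⟨dmul_assoc _ _ _, dmul_assoc _ _ _⟩
  ident_dmul a := Prod.ext_iff.mpr ⟨ident_dmul _, ident_dmul _⟩
  dmul_ident a := Prod.ext_iff.mpr ⟨dmul_ident _, dmul_ident _⟩
  dinv_dmul a := Prod.ext_iff.mpr ⟨dinv_dmul _, dinv_dmul _⟩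
  dmul_dinv a := Prod.ext_iff.mpr ⟨dmul_dinv _, dmul_dinv _⟩
  cmul_assoc a b c := Prod.ext_iff.mpr ⟨cmul_assoc _ _ _, cmul_assoc _ _ _⟩
  ident_cmul a := Prod.ext_iff.mpr ⟨ident_cmul _, ident_cmul _⟩
  cmul_ident a := Prod.ext_iff.mpr ⟨cmul_ident _, cmul_ident _⟩
  cinv_cmul a := Prod.ext_iff.mpr ⟨cinv_cmul _, cinv_cmul _⟩
  cmul_cinv a := Prod.ext_iff.mpr ⟨cmul_cinv _, cmul_cinv _⟩
  compat a b c := Prod.ext_iff.mpr ⟨compat _ _ _, compat _ _ _⟩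

end SkewBrace

namespace SkewBrace

section DotGroup

variable {A : Type u} [SkewBrace A]

/-- The group `(A,·)`. -/
@[reducible] def dotGroup (A : Type u) [SkewBrace A] : Group A where
  mul := dmul
  one := ident
  inv := dinv
  mul_assoc := dmul_assoc
  one_mul := ident_dmul
  mul_one := dmul_ident
  inv_mul_cancel := dinv_dmul

attribute [local instance] dotGroup

theorem lam_eq (a b : A) : lam a b = a⁻¹ * cmul a b := rfl

theorem bstar_eq (a b : A) : bstar a b = lam a b * b⁻¹ := rfl

theorem dcomm_eq (a b : A) : dcomm a b = a * b * a⁻¹ * b⁻¹ := rfl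

theorem cmul_eq (a b : A) : cmul a b = a * lam a b := by
  simp [lam_eq]

/-- `λ_a` as an endomorphism of `(A,·)`. -/
def lamHom (a : A) : A →* A :=
  MonoidHom.mk' (lam a) fun b c => by
    have h : cmul a (b * c) = cmul a b * a⁻¹ * cmul a c := compat a b c
    simp only [lam_eq, h, mul_assoc]

theorem lam_mul (a b c : A) : lam a (b * c) = lam a b * lam a c := (lamHom a).map_mul b c

theorem lam_inv (a b : A) : lam a b⁻¹ = (lam a b)⁻¹ := (lamHom a).map_inv b

theorem lam_cmul (a b c : A) : lam (cmul a b) c = lam a (lam b c) := by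
  rw [lam_eq b c, lam_mul, lam_inv, lam_eq a b, lam_eq a (cmul b c), lam_eq, cmul_assoc]
  group

theorem lam_one_left (b : A) : lam 1 b = b := by
  have h : cmul 1 b = b := ident_cmul b
  rw [lam_eq, h, inv_one, one_mul]

theorem lam_lam_cinv (a b : A) : lam a (lam (cinv a) b) = b := by
  rw [← lam_cmul, cmul_cinv]
  exact lam_one_left b

/-- The properties of a subgroup of `(A,·)` that make `λ` act on the quotient group, with the
subgroup itself acting trivially. -/
class IsDotIdeal (N : Subgroup A) : Prop extends N.Normal where
  lam_mem : ∀ (a : A) {x : A}, x ∈ N → lam a x ∈ N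
  bstar_mem : ∀ {x : A} (b : A), x ∈ N → bstar x b ∈ N

section Quotient

variable (N : Subgroup A) [IsDotIdeal N]

/-- The endomorphism of `(A,·)/N` induced by `λ_a`. -/
def lamQuot (a : A) : A ⧸ N →* A ⧸ N :=
  QuotientGroup.map N N (lamHom a) fun _ hx => IsDotIdeal.lam_mem a hx

theorem lamQuot_mk (a b : A) : lamQuot N a (b : A ⧸ N) = (lam a b : A) := rfl

theorem lamQuot_cmul (a b : A) (q : A ⧸ N) :
    lamQuot N (cmul a b) q = lamQuot N a (lamQuot N b q) := by
  induction q using QuotientGroup.induction_on with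
  | H c => simp only [lamQuot_mk, lam_cmul]

theorem mk_cmul (a b : A) : ((cmul a b : A) : A ⧸ N) = a * lamQuot N a b := by
  rw [cmul_eq]; rfl

variable {N}

theorem bstar_mem_iff {a b : A} : bstar a b ∈ N ↔ lamQuot N a b = (b : A ⧸ N) := by
  rw [← QuotientGroup.eq_one_iff, bstar_eq, QuotientGroup.mk_mul, QuotientGroup.mk_inv,
    mul_inv_eq_one, lamQuot_mk]

theorem dcomm_mem_iff {a b : A} : dcomm a b ∈ N ↔ Commute (a : A ⧸ N) (b : A ⧸ N) := by
  rw [← QuotientGroup.eq_one_iff, dcomm_eq]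
  simp only [QuotientGroup.mk_mul, QuotientGroup.mk_inv]
  rw [mul_inv_eq_one, mul_inv_eq_iff_eq_mul]
  rfl

theorem exists_eq_cmul_of_mk_eq {p q : A} (h : (p : A ⧸ N) = q) : ∃ y ∈ N, p = cmul q y := by
  refine ⟨lam (cinv q) (q⁻¹ * p), IsDotIdeal.lam_mem _ (QuotientGroup.eq.mp h.symm), ?_⟩
  rw [cmul_eq, lam_lam_cinv, mul_inv_cancel_left]

theorem lamQuot_of_mem {x : A} (hx : x ∈ N) (q : A ⧸ N) : lamQuot N x q = q := by
  induction q using QuotientGroup.induction_on with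
  | H b => exact bstar_mem_iff.mp (IsDotIdeal.bstar_mem b hx)

theorem lamQuot_congr {a b : A} (h : (a : A ⧸ N) = b) (q : A ⧸ N) :
    lamQuot N a q = lamQuot N b q := by
  obtain ⟨y, hy, rfl⟩ := exists_eq_cmul_of_mk_eq h
  rw [lamQuot_cmul, lamQuot_of_mem hy]

variable (N) in
/-- Membership in the preimage of the annihilator of the quotient by `N`. -/
def IsAnnMod (a : A) : Prop := ∀ b : A, bstar a b ∈ N ∧ bstar b a ∈ N ∧ dcomm a b ∈ N

theorem isAnnMod_iff {a : A} : IsAnnMod N a ↔ (∀ q : A ⧸ N, lamQuot N a q = q) ∧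
    (∀ b : A, lamQuot N b a = (a : A ⧸ N)) ∧ ∀ q : A ⧸ N, Commute (a : A ⧸ N) q := by
  simp only [IsAnnMod, bstar_mem_iff, dcomm_mem_iff, forall_and]
  rw [QuotientGroup.mk_surjective.forall, QuotientGroup.mk_surjective.forall]

theorem IsAnnMod.congr {a b : A} (ha : IsAnnMod N a) (h : (b : A ⧸ N) = a) : IsAnnMod N b := by
  rw [isAnnMod_iff] at ha ⊢
  simp only [h, lamQuot_congr h]
  exact ha

theorem isAnnMod_one : IsAnnMod N (1 : A) := by
  rw [isAnnMod_iff]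
  refine ⟨fun q => lamQuot_of_mem N.one_mem q, fun b => ?_, fun q => ?_⟩
  · exact map_one (lamQuot N b)
  · exact Commute.one_left q

theorem isAnnMod_of_mem {a : A} (ha : a ∈ N) : IsAnnMod N a :=
  isAnnMod_one.congr ((QuotientGroup.eq_one_iff a).mpr ha)

theorem IsAnnMod.mk_cmul {a : A} (ha : IsAnnMod N a) (b : A) :
    ((cmul b a : A) : A ⧸ N) = b * a := by
  rw [SkewBrace.mk_cmul, (isAnnMod_iff.mp ha).2.1]

theorem IsAnnMod.mul {a b : A} (ha : IsAnnMod N a) (hb : IsAnnMod N b) : IsAnnMod N (a * b) := by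
  have hc : ((a * b : A) : A ⧸ N) = (cmul a b : A) := (hb.mk_cmul a).symm
  rw [isAnnMod_iff] at ha hb ⊢
  refine ⟨fun q => ?_, fun c => ?_, fun q => (ha.2.2 q).mul_left (hb.2.2 q)⟩
  · rw [lamQuot_congr hc, lamQuot_cmul, hb.1, ha.1]
  · rw [QuotientGroup.mk_mul, map_mul, ha.2.1, hb.2.1]

theorem IsAnnMod.inv {a : A} (ha : IsAnnMod N a) : IsAnnMod N a⁻¹ := by
  rw [isAnnMod_iff] at ha ⊢
  have h (c : A) : lamQuot N c (a⁻¹ : A) = ((a⁻¹ : A) : A ⧸ N) := by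
    rw [QuotientGroup.mk_inv, map_inv, ha.2.1]
  refine ⟨fun q => ?_, h, fun q => (ha.2.2 q).inv_left⟩
  have hc : ((cmul a a⁻¹ : A) : A ⧸ N) = (1 : A) := by
    rw [SkewBrace.mk_cmul, h, ← QuotientGroup.mk_mul, mul_inv_cancel]
  rw [← ha.1 (lamQuot N a⁻¹ q), ← lamQuot_cmul, lamQuot_congr hc, lamQuot_of_mem N.one_mem]

variable (N) in
/-- The preimage of the annihilator of the quotient by `N`, as a subgroup of `(A,·)`. -/
def annMod : Subgroup A where
  carrier := {a | IsAnnMod N a}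
  mul_mem' := IsAnnMod.mul
  one_mem' := isAnnMod_one
  inv_mem' := IsAnnMod.inv

theorem mem_annMod {a : A} : a ∈ annMod N ↔ IsAnnMod N a := Iff.rfl

instance annMod_isDotIdeal : IsDotIdeal (annMod N) where
  conj_mem a ha b := ha.congr <| by
    simp only [QuotientGroup.mk_mul, QuotientGroup.mk_inv]
    rw [← ((isAnnMod_iff.mp ha).2.2 b).eq, mul_inv_cancel_right]
  lam_mem b a ha := IsAnnMod.congr ha ((isAnnMod_iff.mp ha).2.1 b)
  bstar_mem b ha := isAnnMod_of_mem (ha b).1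

end Quotient

instance bot_isDotIdeal : IsDotIdeal (⊥ : Subgroup A) where
  lam_mem a x hx := by
    rw [Subgroup.mem_bot] at hx ⊢
    rw [hx]
    exact map_one (lamHom a)
  bstar_mem b hx := by
    rw [Subgroup.mem_bot] at hx ⊢
    rw [hx, bstar_eq, lam_one_left, mul_inv_cancel]

theorem exists_subgroup_eq_annS (n : ℕ) :
    ∃ N : Subgroup A, IsDotIdeal N ∧ ∀ a, a ∈ N ↔ a ∈ AnnS A n := by
  induction n with
  | zero => exact ⟨⊥, bot_isDotIdeal, fun a => Subgroup.mem_bot⟩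
  | succ n ih =>
    obtain ⟨N, hN, h⟩ := ih
    refine ⟨annMod N, inferInstance, fun a => ?_⟩
    simp only [mem_annMod, IsAnnMod, h]
    rfl

theorem dclosure_mem_subgroup {S : Set A} {x : A} (hx : x ∈ dcl S) {H : Subgroup A}
    (h : S ⊆ H) : x ∈ H := by
  induction hx with
  | mem hx => exact h hx
  | one => exact H.one_mem
  | mul _ _ hx hy => exact H.mul_mem hx hy
  | inv _ hx => exact H.inv_mem hx

theorem dcl_mono {S T : Set A} (h : S ⊆ T) : dcl S ⊆ dcl T := by
  intro x hx
  induction hx with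
  | mem hx => exact .mem (h hx)
  | one => exact .one
  | mul _ _ hx hy => exact .mul hx hy
  | inv _ hx => exact .inv hx

theorem gammaBar_succ_subset (k : ℕ) : GammaBar A (k + 2) ⊆ GammaBar A (k + 1) := by
  induction k with
  | zero => exact fun _ _ => Set.mem_univ _
  | succ k ih =>
    refine dcl_mono (Set.union_subset_union ?_ ?_)
    · rintro _ ⟨a, ha, b, hb, rfl⟩
      exact ⟨a, ha, b, ih hb, rfl⟩
    · rintro _ ⟨a, ha, b, hb, rfl⟩
      exact ⟨a, ha, b, ih hb, rfl⟩

theorem mul_mem_gammaBar {k : ℕ} {x y : A} (hx : x ∈ GammaBar A (k + 1))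
    (hy : y ∈ GammaBar A (k + 1)) : x * y ∈ GammaBar A (k + 1) := by
  cases k with
  | zero => exact Set.mem_univ _
  | succ k => exact dclosure.mul hx hy

theorem lam_mem_gammaBar {k : ℕ} (a : A) {w : A} (hw : w ∈ GammaBar A (k + 1)) :
    lam a w ∈ GammaBar A (k + 1) := by
  have h : bstar a w ∈ GammaBar A (k + 2) := .mem (.inl ⟨a, Set.mem_univ _, w, hw, rfl⟩)
  have := mul_mem_gammaBar (gammaBar_succ_subset k h) hw
  rwa [bstar_eq, inv_mul_cancel_right] at this

theorem conj_mem_gammaBar {k : ℕ} (a : A) {w : A} (hw : w ∈ GammaBar A (k + 1)) :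
    a * w * a⁻¹ ∈ GammaBar A (k + 1) := by
  have h : dcomm a w ∈ GammaBar A (k + 2) := .mem (.inr ⟨a, Set.mem_univ _, w, hw, rfl⟩)
  have := mul_mem_gammaBar (gammaBar_succ_subset k h) hw
  rwa [dcomm_eq, inv_mul_cancel_right] at this

section Fixing

variable (N : Subgroup A) [IsDotIdeal N]

/-- The elements on which `u` acts trivially modulo `N`, both by conjugation and by `λ`. -/
def fixedMod (u : A) : Subgroup A where
  carrier := {v | Commute (u : A ⧸ N) (v : A ⧸ N) ∧ lamQuot N u v = (v : A ⧸ N)}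
  mul_mem' {v w} hv hw := ⟨hv.1.mul_right hw.1, by
    rw [QuotientGroup.mk_mul, map_mul, hv.2, hw.2]⟩
  one_mem' := ⟨Commute.one_right _, map_one (lamQuot N u)⟩
  inv_mem' {v} hv := ⟨hv.1.inv_right, by rw [QuotientGroup.mk_inv, map_inv, hv.2]⟩

variable {N}

theorem mem_fixedMod {u v : A} : v ∈ fixedMod N u ↔ dcomm u v ∈ N ∧ bstar u v ∈ N := by
  rw [dcomm_mem_iff, bstar_mem_iff]; rfl

theorem commute_of_mem_annMod {c : A} (hc : c ∈ annMod N) (q : A ⧸ N) : Commute (c : A ⧸ N) q :=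
  (isAnnMod_iff.mp hc).2.2 q

theorem mk_conj (u v : A) :
    (u : A ⧸ N) * v * (u : A ⧸ N)⁻¹ = (dcomm u v : A) * (v : A ⧸ N) := by
  rw [dcomm_eq]
  simp only [QuotientGroup.mk_mul, QuotientGroup.mk_inv, inv_mul_cancel_right]

theorem lamQuot_mk_eq_bstar_mul (u v : A) :
    lamQuot N u v = (bstar u v : A) * (v : A ⧸ N) := by
  rw [bstar_eq, QuotientGroup.mk_mul, QuotientGroup.mk_inv, inv_mul_cancel_right, lamQuot_mk]

/-- It suffices for `x` and `w` to be moved by the same central factors to have `x * w⁻¹` fixed. -/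
theorem mul_inv_mem_fixedMod {u w x : A} (hc : dcomm u w ∈ annMod N) (hd : bstar u w ∈ annMod N)
    (hcx : (u : A ⧸ N) * x * (u : A ⧸ N)⁻¹ = (dcomm u w : A) * (x : A ⧸ N))
    (hdx : lamQuot N u x = (bstar u w : A) * (x : A ⧸ N)) : x * w⁻¹ ∈ fixedMod N u := by
  have key {c p q : A ⧸ N} (h : Commute c (p * q⁻¹)) : (c * p) * (c * q)⁻¹ = p * q⁻¹ := by
    rw [mul_inv_rev, ← mul_assoc, mul_assoc c, h.eq, mul_inv_cancel_right]
  constructor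
  · have h := key (commute_of_mem_annMod hc ((x : A ⧸ N) * (w : A ⧸ N)⁻¹))
    rw [← hcx, ← mk_conj] at h
    rw [QuotientGroup.mk_mul, QuotientGroup.mk_inv]
    refine mul_inv_eq_iff_eq_mul.mp (Eq.trans ?_ h)
    group
  · rw [QuotientGroup.mk_mul, QuotientGroup.mk_inv, map_mul, map_inv, hdx,
      lamQuot_mk_eq_bstar_mul u w]
    exact key (commute_of_mem_annMod hd _)

variable {M : Subgroup A} {u a w : A}

theorem dcomm_mem_fixedMod (hu : IsAnnMod M u) (hc : dcomm u w ∈ annMod N)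
    (hd : bstar u w ∈ annMod N) (hfix : ∀ z ∈ M, a * w * a⁻¹ ∈ fixedMod N z) :
    dcomm a w ∈ fixedMod N u := by
  have key {c e p q : A ⧸ N} (hc : ∀ r, Commute c r) (he : Commute e (p * q * p⁻¹)) :
      (e * p) * (c * q) * (e * p)⁻¹ = c * (p * q * p⁻¹) := by
    calc (e * p) * (c * q) * (e * p)⁻¹ = (e * p) * c * q * p⁻¹ * e⁻¹ := by group
      _ = c * (e * (p * q * p⁻¹) * e⁻¹) := by rw [← (hc (e * p)).eq]; group
      _ = c * (p * q * p⁻¹) := by rw [he.eq, mul_inv_cancel_right]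
  rw [dcomm_eq]
  refine mul_inv_mem_fixedMod hc hd ?_ ?_
  · have h := key (p := (a : A ⧸ N)) (q := w) (commute_of_mem_annMod hc) (hfix _ (hu a).2.2).1
    rw [← mk_conj, ← mk_conj] at h
    refine Eq.trans ?_ h
    simp only [QuotientGroup.mk_mul, QuotientGroup.mk_inv]
    group
  · have h := key (p := (a : A ⧸ N)) (q := w) (commute_of_mem_annMod hd) (hfix _ (hu a).1).1
    rw [← lamQuot_mk_eq_bstar_mul, ← lamQuot_mk_eq_bstar_mul] at h
    refine Eq.trans ?_ h
    simp only [QuotientGroup.mk_mul, QuotientGroup.mk_inv, map_mul, map_inv]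

theorem bstar_mem_fixedMod [IsDotIdeal M] (hu : IsAnnMod M u) (hc : dcomm u w ∈ annMod N)
    (hd : bstar u w ∈ annMod N) (hfix : ∀ z ∈ M, w ∈ fixedMod N z)
    (hfix' : ∀ z ∈ M, lam a w ∈ fixedMod N z) : bstar a w ∈ fixedMod N u := by
  rw [bstar_eq]
  refine mul_inv_mem_fixedMod hc hd ?_ ?_
  · have h := congrArg (lamQuot N a) (mk_conj (N := N) u w)
    simp only [map_mul, map_inv] at h
    rw [lamQuot_mk_eq_bstar_mul a u, (isAnnMod_iff.mp hc).2.1, lamQuot_mk] at h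
    have he := (hfix' _ (hu a).2.1).1
    have hce := commute_of_mem_annMod hc ((bstar a u : A) : A ⧸ N)
    generalize ((bstar a u : A) : A ⧸ N) = e at *
    calc (u : A ⧸ N) * (lam a w : A) * (u : A ⧸ N)⁻¹
        = e⁻¹ * (e * u * (lam a w : A) * (e * (u : A ⧸ N))⁻¹) * e := by group
      _ = (dcomm u w : A) * (lam a w : A) := by
        rw [h, mul_assoc, (hce.mul_left he.symm).eq, inv_mul_cancel_left]
  · have hcomm : ((cmul u a : A) : A ⧸ M) = (cmul a u : A) := by
      obtain ⟨h₁, -, h₃⟩ := isAnnMod_iff.mp hu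
      rw [hu.mk_cmul, mk_cmul, h₁, (h₃ a).eq]
    obtain ⟨y, hy, h⟩ := exists_eq_cmul_of_mk_eq hcomm
    rw [← lamQuot_mk, ← lamQuot_cmul, h, lamQuot_cmul, lamQuot_cmul, (hfix y hy).2,
      lamQuot_mk_eq_bstar_mul u w, map_mul, (isAnnMod_iff.mp hd).2.1]

end Fixing

theorem dcomm_bstar_mem_annS_add (k : ℕ) : ∀ (t : ℕ) {u v : A}, u ∈ AnnS A (t + (k + 1)) →
    v ∈ GammaBar A (k + 1) → dcomm u v ∈ AnnS A t ∧ bstar u v ∈ AnnS A t := by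
  induction k with
  | zero => exact fun t u v hu _ => ⟨(hu v).2.2, (hu v).1⟩
  | succ k ih =>
    intro t u v hu hv
    obtain ⟨N, hN, hNmem⟩ := exists_subgroup_eq_annS (A := A) t
    obtain ⟨M, hM, hMmem⟩ := exists_subgroup_eq_annS (A := A) (t + (k + 1))
    have hu' : IsAnnMod M u := by
      simp only [IsAnnMod, hMmem]
      exact hu
    have hfix (z : A) (hz : z ∈ M) (w : A) (hw : w ∈ GammaBar A (k + 1)) : w ∈ fixedMod N z := by
      simpa only [mem_fixedMod, hNmem] using ih t ((hMmem z).mp hz) hw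
    have hcentral (w : A) (hw : w ∈ GammaBar A (k + 1)) :
        dcomm u w ∈ annMod N ∧ bstar u w ∈ annMod N := by
      have hu₁ : u ∈ AnnS A (t + 1 + (k + 1)) := by rwa [add_right_comm]
      simp only [mem_annMod, IsAnnMod, hNmem]
      exact ih (t + 1) hu₁ hw
    simp only [← hNmem]
    rw [← mem_fixedMod]
    refine dclosure_mem_subgroup hv (Set.union_subset ?_ ?_)
    · rintro _ ⟨a, -, w, hw, rfl⟩
      exact bstar_mem_fixedMod hu' (hcentral w hw).1 (hcentral w hw).2
        (fun z hz => hfix z hz w hw) fun z hz => hfix z hz _ (lam_mem_gammaBar a hw)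
    · rintro _ ⟨a, -, w, hw, rfl⟩
      exact dcomm_mem_fixedMod hu' (hcentral w hw).1 (hcentral w hw).2
        fun z hz => hfix z hz _ (conj_mem_gammaBar a hw)

end DotGroup

end SkewBrace

open SkewBrace in
/-- For all integers `s ≥ r ≥ 1`, all `x ∈ Ann_s(A)` and all `v ∈ Γ̄_r(A)`, both
`[x,v]· ∈ Ann_{s-r}(A)` and `x * v ∈ Ann_{s-r}(A)`. -/
theorem dcomm_bstar_mem_annS (A : Type u) [SkewBrace A] (s r : ℕ) (hr : 1 ≤ r) (hrs : r ≤ s)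
    (x : A) (hx : x ∈ AnnS A s) (v : A) (hv : v ∈ GammaBar A r) :
    dcomm x v ∈ AnnS A (s - r) ∧ bstar x v ∈ AnnS A (s - r) := by
  obtain ⟨k, rfl⟩ := Nat.exists_eq_add_of_le' hr
  obtain ⟨t, rfl⟩ := Nat.exists_eq_add_of_le' hrs
  rw [Nat.add_sub_cancel]
  exact dcomm_bstar_mem_annS_add k t hx hv
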